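/- arXiv:1906.12206 — 2 statements merged into one kernel-verified Lean document; each statement's English description precedes it below -/
import Mathlib

section
/- Let l be a prime with l ≡ 4 (mod 5) for which (−4|l) = −1 (so that j = 1728 is a supersingular j-invariant in characteristic l). Then f₁₇₂₈(x) = x⁴ + 18x³ + 74x² − 18x + 1 splits into distinct linear factors over 𝔽_l, i.e., f₁₇₂₈ has 4 distinct roots in 𝔽_l. -/
open Polynomial

/-- In a finite field, a product of two nonsquares is a square. -/
theorem FiniteField.isSquare_mul_of_not_isSquare {F : Type*} [Field F] [Fintype F]
    {a b : F} (ha : ¬ IsSquare a) (hb : ¬ IsSquare b) :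
    IsSquare (a * b) := by
  classical
  have ha0 : a ≠ 0 := by rintro rfl; exact ha (IsSquare.zero)
  have hb0 : b ≠ 0 := by rintro rfl; exact hb (IsSquare.zero)
  rw [← quadraticChar_one_iff_isSquare (mul_ne_zero ha0 hb0), map_mul,
    quadraticChar_neg_one_iff_not_isSquare.2 ha, quadraticChar_neg_one_iff_not_isSquare.2 hb]
  norm_num

theorem ZMod.isSquare_five {l : ℕ} [Fact l.Prime] (hl5 : l % 5 = 4) (hl2 : l ≠ 2) :
    IsSquare (5 : ZMod l) := by
  have : Fact (Nat.Prime 5) := ⟨by norm_num⟩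
  have h := ZMod.exists_sq_eq_prime_iff_of_mod_four_eq_one (p := 5) (q := l) (by norm_num) hl2
  have h4 : ((l : ℕ) : ZMod 5) = 4 := by
    rw [← ZMod.natCast_mod, hl5]; rfl
  rw [h4] at h
  simpa using h.1 ⟨2, by norm_num⟩

theorem ZMod.natCast_prime_ne_zero {l q : ℕ} [Fact l.Prime] (hq : q.Prime) (h : l ≠ q) :
    (q : ZMod l) ≠ 0 := fun h0 =>
  h ((Nat.prime_dvd_prime_iff_eq Fact.out hq).1 ((ZMod.natCast_eq_zero_iff q l).1 h0))

/-- If `-4 * (10 + 2 * √5)` were a square, `ZMod l` would contain a primitive fifth root of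
unity. -/
theorem ZMod.isSquare_ten_add_two_mul {l : ℕ} [Fact l.Prime] (hl5 : l % 5 = 4) (hl2 : l ≠ 2)
    (h4 : ¬ IsSquare (-4 : ZMod l)) {s : ZMod l} (hs : s ^ 2 = 5) :
    IsSquare (10 + 2 * s) := by
  by_contra hd
  obtain ⟨t, ht⟩ := FiniteField.isSquare_mul_of_not_isSquare h4 hd
  have h2 : (2 : ZMod l) ≠ 0 := by exact_mod_cast ZMod.natCast_prime_ne_zero Nat.prime_two hl2
  have h5 : (5 : ZMod l) ≠ 0 := by
    exact_mod_cast ZMod.natCast_prime_ne_zero (q := 5) (by norm_num) (by omega)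
  have h8 : (8 : ZMod l) ≠ 0 := by
    rw [show (8 : ZMod l) = 2 ^ 3 by norm_num]; exact pow_ne_zero _ h2
  obtain ⟨z, hz⟩ : ∃ z : ZMod l, 8 * z = 2 * s - 2 + t :=
    ⟨(2 * s - 2 + t) / 8, by field_simp⟩
  have hq : 2 * z ^ 2 - (s - 1) * z + 2 = 0 := by
    have : 32 * (2 * z ^ 2 - (s - 1) * z + 2) = 0 := by
      linear_combination (8 * z - (2 * s - 2) + t) * hz - ht - 4 * hs
    rw [show (32 : ZMod l) = 2 ^ 5 by norm_num] at this
    exact (mul_eq_zero.1 this).resolve_left (pow_ne_zero _ h2)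
  have hz5 : z ^ 5 = 1 := by
    have : 2 ^ 2 * (z ^ 5 - 1) = 0 := by
      linear_combination (z - 1) * (2 * z ^ 2 + (s + 1) * z + 2) * hq + (z - 1) * z ^ 2 * hs
    exact sub_eq_zero.1 ((mul_eq_zero.1 this).resolve_left (pow_ne_zero _ h2))
  have hz1 : z ≠ 1 := by
    rintro rfl
    have : 2 ^ 2 * (5 : ZMod l) = 0 := by
      linear_combination (s + 5) * hq + hs
    exact mul_ne_zero (pow_ne_zero _ h2) h5 this
  have : Fact (Nat.Prime 5) := ⟨by norm_num⟩
  have ho := orderOf_eq_prime hz5 hz1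
  have hz0 : z ≠ 0 := by rintro rfl; norm_num at hz5
  have hdvd := orderOf_dvd_of_pow_eq_one (ZMod.pow_card_sub_one_eq_one hz0)
  rw [ho] at hdvd
  have := (Fact.out : l.Prime).two_le
  omega

/-- If `l ≡ 4 (mod 5)` is a prime with `(-4|l) = -1` (so `j = 1728` is supersingular in
characteristic `l`), then `f₁₇₂₈(x) = x⁴+18x³+74x²-18x+1` splits into distinct linear
factors over `𝔽_l`, i.e. it has 4 distinct roots in `𝔽_l`. -/
theorem f1728_four_roots (l : ℕ) [Fact l.Prime] (hl5 : l % 5 = 4)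
    (h4 : legendreSym l (-4) = -1) :
    ((X ^ 4 + 18 * X ^ 3 + 74 * X ^ 2 - 18 * X + 1 :
        Polynomial (ZMod l))).roots.toFinset.card = 4 := by
  have hn4 : ¬ IsSquare (-4 : ZMod l) := by
    simpa using (legendreSym.eq_neg_one_iff l).1 h4
  have hl2 : l ≠ 2 := by
    rintro rfl
    norm_num at hl5
  have h2 : (2 : ZMod l) ≠ 0 := by exact_mod_cast ZMod.natCast_prime_ne_zero Nat.prime_two hl2
  have h3 : (3 : ZMod l) ≠ 0 := by
    exact_mod_cast ZMod.natCast_prime_ne_zero Nat.prime_three (by omega)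
  have h5 : (5 : ZMod l) ≠ 0 := by
    exact_mod_cast ZMod.natCast_prime_ne_zero (q := 5) (by norm_num) (by omega)
  obtain ⟨s, hs⟩ := ZMod.isSquare_five hl5 hl2
  have hs2 : s ^ 2 = 5 := by rw [hs, sq]
  obtain ⟨u, hu⟩ := ZMod.isSquare_ten_add_two_mul hl5 hl2 hn4 hs2
  obtain ⟨v, hv⟩ := ZMod.isSquare_ten_add_two_mul hl5 hl2 hn4 (s := -s) (by rw [neg_sq, hs2])
  have hs0 : s ≠ 0 := by rintro rfl; exact h5 (by simpa using hs)
  have huv : (u * v) ^ 2 = 2 ^ 4 * 5 := by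
    linear_combination -(v * v) * hu - (10 + 2 * s) * hv - 4 * hs2
  have huv0 : u * v ≠ 0 := fun h => by
    rw [h] at huv
    exact mul_ne_zero (pow_ne_zero 4 h2) h5 (by rw [← huv]; ring)
  have hu0 := left_ne_zero_of_mul huv0
  have hv0 := right_ne_zero_of_mul huv0
  set f : Polynomial (ZMod l) := X ^ 4 + 18 * X ^ 3 + 74 * X ^ 2 - 18 * X + 1 with hf
  have hdeg : f.natDegree = 4 := by
    rw [hf]; compute_degree!
  have hf0 : f ≠ 0 := by
    intro h; rw [h] at hdeg; simp at hdeg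
  have quad_root : ∀ r w x : ZMod l, r ^ 2 = 5 → w * w = 10 + 2 * r →
      2 * x = -9 - r + 3 * w → x ^ 2 + (9 + r) * x - 1 = 0 := by
    intro r w x hr hw hx
    have : 2 ^ 2 * (x ^ 2 + (9 + r) * x - 1) = 0 := by
      linear_combination (2 * x + 9 + r + 3 * w) * hx + 9 * hw - hr
    exact (mul_eq_zero.1 this).resolve_left (pow_ne_zero _ h2)
  have isRoot : ∀ r x : ZMod l, r ^ 2 = 5 → x ^ 2 + (9 + r) * x - 1 = 0 → x ∈ f.roots := by
    intro r x hr hx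
    rw [mem_roots hf0, IsRoot, hf]
    simp only [eval_add, eval_sub, eval_mul, eval_pow, eval_X, eval_one, eval_ofNat]
    linear_combination (x ^ 2 + (9 - r) * x - 1) * hx + x ^ 2 * hr
  have cross : ∀ x y : ZMod l, x ^ 2 + (9 + s) * x - 1 = 0 →
      y ^ 2 + (9 + -s) * y - 1 = 0 → x ≠ y := by
    rintro x _ hx hy rfl
    have h : 2 * s * x = 0 := by linear_combination hx - hy
    have hx0 : x = 0 := (mul_eq_zero.1 h).resolve_left (mul_ne_zero h2 hs0)
    simp [hx0] at hx
  have distinct : ∀ w x y r : ZMod l, w ≠ 0 → 2 * x = r + 3 * w → 2 * y = r + 3 * -w →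
      x ≠ y := by
    rintro w x _ r hw hx hy rfl
    exact mul_ne_zero (mul_ne_zero h2 h3) hw (by linear_combination hy - hx)
  have half : ∀ c : ZMod l, ∃ x, 2 * x = c := fun c => ⟨c / 2, by field_simp⟩
  have hns : (-s) ^ 2 = 5 := by rw [neg_sq, hs2]
  obtain ⟨a, ha⟩ := half (-9 - s + 3 * u)
  obtain ⟨b, hb⟩ := half (-9 - s + 3 * -u)
  obtain ⟨c, hc⟩ := half (-9 - -s + 3 * v)
  obtain ⟨d, hd⟩ := half (-9 - -s + 3 * -v)
  have qa := quad_root s u a hs2 hu.symm ha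
  have qb := quad_root s (-u) b hs2 (by rw [hu]; ring) hb
  have qc := quad_root (-s) v c hns hv.symm hc
  have qd := quad_root (-s) (-v) d hns (by rw [hv]; ring) hd
  have hcard : ({a, b, c, d} : Finset (ZMod l)).card = 4 := by
    simp [Finset.card_insert_of_notMem, distinct u a b _ hu0 ha hb, distinct v c d _ hv0 hc hd,
      cross a c qa qc, cross a d qa qd, cross b c qb qc, cross b d qb qd]
  apply le_antisymm
  · exact (Multiset.toFinset_card_le _).trans ((card_roots' f).trans hdeg.le)
  · rw [← hcard]
    apply Finset.card_le_card
    intro x hx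
    simp only [Finset.mem_insert, Finset.mem_singleton] at hx
    rw [Multiset.mem_toFinset]
    rcases hx with rfl | rfl | rfl | rfl
    · exact isRoot s _ hs2 qa
    · exact isRoot s _ hs2 qb
    · exact isRoot (-s) _ hns qc
    · exact isRoot (-s) _ hns qd
end

section
/- Let l be a prime with l ≡ 1 (mod 5) for which (−4|l) = −1. Then over 𝔽_l the polynomial f₁₇₂₈(x) = x⁴ + 18x³ + 74x² − 18x + 1 splits into a product of two distinct irreducible quadratics of the form x² + ax − 1: there exist a₁ ≠ a₂ in 𝔽_l such that f₁₇₂₈(x) = (x² + a₁x − 1)(x² + a₂x − 1) in 𝔽_l[x], with both factors irreducible over 𝔽_l. -/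
open Polynomial

/-- If a prime `n` divides `l - 1`, then `𝔽_l` contains a primitive `n`-th root of unity. -/
lemma ZMod.exists_isPrimitiveRoot_of_dvd_sub_one (l n : ℕ) [Fact l.Prime] [Fact n.Prime]
    (h : n ∣ l - 1) : ∃ ζ : ZMod l, IsPrimitiveRoot ζ n := by
  obtain ⟨u, hu⟩ := exists_prime_orderOf_dvd_card (G := (ZMod l)ˣ) n (by rwa [ZMod.card_units])
  exact ⟨u, IsPrimitiveRoot.coe_units_iff.mpr (hu ▸ IsPrimitiveRoot.orderOf u)⟩

/-- If `-4` is not a square and `a² + 4 = -t²` with `t ≠ 0`, then `x² + ax - 1` is irreducible. -/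
lemma irreducible_X_sq_add_C_mul_X_sub_one {K : Type*} [Field K] (h4 : ¬IsSquare (-4 : K))
    {a t : K} (ht : t ≠ 0) (ha : a ^ 2 + 4 = -t ^ 2) :
    Irreducible (X ^ 2 + C a * X - 1 : K[X]) := by
  have hdeg : (X ^ 2 + C a * X - 1 : K[X]).natDegree = 2 := by compute_degree!
  refine irreducible_of_degree_le_three_of_not_isRoot (by simp [hdeg]) fun x hx ↦ h4 ?_
  have hx' : x ^ 2 + a * x - 1 = 0 := by simpa [IsRoot] using hx
  refine ⟨2 * (2 * x + a) / t, ?_⟩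
  field_simp
  linear_combination (-16) * hx' - 4 * ha

/-- If `l ≡ 1 (mod 5)` is a prime with `(-4|l) = -1`, then over `𝔽_l` the polynomial
`f₁₇₂₈(x) = x⁴+18x³+74x²-18x+1` splits into a product of two distinct irreducible
quadratics of the form `x² + ax - 1`. -/
theorem f1728_splits_two_quadratics (l : ℕ) [Fact l.Prime] (hl5 : l % 5 = 1)
    (h4 : legendreSym l (-4) = -1) :
    ∃ a₁ a₂ : ZMod l, a₁ ≠ a₂ ∧
      (X ^ 4 + 18 * X ^ 3 + 74 * X ^ 2 - 18 * X + 1 : Polynomial (ZMod l)) =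
        (X ^ 2 + C a₁ * X - 1) * (X ^ 2 + C a₂ * X - 1) ∧
      Irreducible (X ^ 2 + C a₁ * X - 1 : Polynomial (ZMod l)) ∧
      Irreducible (X ^ 2 + C a₂ * X - 1 : Polynomial (ZMod l)) := by
  have hnsq : ¬IsSquare (-4 : ZMod l) := by
    simpa using (legendreSym.eq_neg_one_iff l).mp h4
  have : Fact (Nat.Prime 5) := ⟨Nat.prime_five⟩
  obtain ⟨z, hz⟩ := ZMod.exists_isPrimitiveRoot_of_dvd_sub_one l 5 (by omega)
  have hsum : 1 + z + z ^ 2 + z ^ 3 + z ^ 4 = 0 := by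
    simpa [Finset.sum_range_succ] using hz.geom_sum_eq_zero (by norm_num)
  have hprime {p : ℕ} (hp : p.Prime) (hp5 : p % 5 ≠ 1) : (p : ZMod l) ≠ 0 := by
    rw [Ne, ZMod.natCast_eq_zero_iff, Nat.prime_dvd_prime_iff_eq Fact.out hp]
    rintro rfl
    exact hp5 hl5
  have h2 : (2 : ZMod l) ≠ 0 := hprime Nat.prime_two (by norm_num)
  have h3 : (3 : ZMod l) ≠ 0 := hprime Nat.prime_three (by norm_num)
  have h5 : (5 : ZMod l) ≠ 0 := hprime Nat.prime_five (by norm_num)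
  obtain ⟨s, hs⟩ : ∃ s, s = 1 + 2 * (z + z ^ 4) := ⟨_, rfl⟩
  have hz5 : z ^ 5 = 1 := hz.pow_eq_one
  have hs5 : s ^ 2 = 5 := by grind
  have ht : (9 + s) ^ 2 + 4 = -(6 * (z - z ^ 4)) ^ 2 := by grind
  have ht' : (9 - s) ^ 2 + 4 = -(6 * (z ^ 2 - z ^ 3)) ^ 2 := by grind
  have hprod : ((9 + s) ^ 2 + 4) * ((9 - s) ^ 2 + 4) = 2 ^ 4 * 3 ^ 4 * 5 := by grind
  have hne : ((9 + s) ^ 2 + 4) * ((9 - s) ^ 2 + 4) ≠ 0 := by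
    rw [hprod]
    exact mul_ne_zero (mul_ne_zero (pow_ne_zero _ h2) (pow_ne_zero _ h3)) h5
  rw [ht, ht'] at hne
  refine ⟨9 + s, 9 - s, fun h ↦ ?_, ?_,
    irreducible_X_sq_add_C_mul_X_sub_one hnsq (fun h ↦ hne (by simp [h])) ht,
    irreducible_X_sq_add_C_mul_X_sub_one hnsq (fun h ↦ hne (by simp [h])) ht'⟩
  · have hs0 : s = 0 := (mul_eq_zero.mp (by linear_combination h : 2 * s = 0)).resolve_left h2
    exact h5 (by rw [← hs5, hs0]; ring)
  · have hC : (C s : (ZMod l)[X]) ^ 2 = 5 := by rw [← C_pow, hs5]; rfl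
    have h9 : (C 9 : (ZMod l)[X]) = 9 := rfl
    rw [C_add, C_sub, h9]
    linear_combination X ^ 2 * hC
end
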